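/- For all integers n and k with 0 ≤ k < n, the integral identity n · binomial(n−1, k) · ∫_0^1 t^k (1−t)^{n−k−1} ln(t) dt = H_k − H_n holds. -/

import Mathlib

open MeasureTheory Finset

attribute [local instance] Classical.propDecidable

noncomputable def harm (q : ℕ) : ℝ := ∑ m ∈ Finset.range q, (1 : ℝ) / (m + 1)

noncomputable def linExts (α : Type) [Fintype α] (r : α → α → Prop) :
    Finset (α ≃ Fin (Fintype.card α)) :=
  Finset.univ.filter fun σ => ∀ i j : α, r i j → σ i ≤ σ j

noncomputable def dN {α : Type} [Fintype α] (r : α → α → Prop)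
    (σ : α ≃ Fin (Fintype.card α)) (i : α) : ℕ :=
  if ∀ j : α, r j i → j = i then (σ i : ℕ) + 1
  else sInf {m : ℕ | ∃ j : α, j ≠ i ∧ r j i ∧ m = (σ i : ℕ) - (σ j : ℕ)}

noncomputable def QLB (α : Type) [Fintype α] (r : α → α → Prop) : ℝ :=
  (∑ σ ∈ linExts α r, ∑ i : α, harm (dN r σ i - 1)) / ((linExts α r).card : ℝ)

def chainPolytope (α : Type) [Fintype α] (r : α → α → Prop) : Set (α → ℝ) :=
  {y | (∀ i, 0 ≤ y i) ∧
    ∀ C : Finset α, (∀ i ∈ C, ∀ j ∈ C, r i j ∨ r j i) → ∑ i ∈ C, y i ≤ 1}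

def orderPolytope (α : Type) [Fintype α] (r : α → α → Prop) : Set (α → ℝ) :=
  {y | (∀ i, 0 ≤ y i ∧ y i ≤ 1) ∧ ∀ i j : α, r i j → y i ≤ y j}

noncomputable def transferMap (α : Type) [Fintype α] (r : α → α → Prop)
    (y : α → ℝ) (i : α) : ℝ :=
  if ∀ j : α, r j i → j = i then y i
  else sInf {t : ℝ | ∃ j : α, j ≠ i ∧ r j i ∧ t = y i - y j}

noncomputable def QH (α : Type) [Fintype α] (r : α → α → Prop) : ℝ :=
  ⨍ z in chainPolytope α r, -(1 / (Fintype.card α : ℝ)) * ∑ i : α, Real.log (z i)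

noncomputable def posetEntropy (α : Type) [Fintype α] (r : α → α → Prop) : ℝ :=
  sInf {x : ℝ | ∃ z ∈ chainPolytope α r, (∀ i, 0 < z i) ∧
    x = -(1 / (Fintype.card α : ℝ)) * ∑ i : α, Real.log (z i)}

def seriesComp {α β : Type} (r : α → α → Prop) (s : β → β → Prop) :
    α ⊕ β → α ⊕ β → Prop
  | Sum.inl x, Sum.inl y => r x y
  | Sum.inr x, Sum.inr y => s x y
  | Sum.inl _, Sum.inr _ => True
  | Sum.inr _, Sum.inl _ => False

def parallelComp {α β : Type} (r : α → α → Prop) (s : β → β → Prop) :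
    α ⊕ β → α ⊕ β → Prop
  | Sum.inl x, Sum.inl y => r x y
  | Sum.inr x, Sum.inr y => s x y
  | _, _ => False

lemma harm_succ (q : ℕ) : harm (q + 1) = harm q + 1 / ((q : ℝ) + 1) := by
  simp [harm, Finset.sum_range_succ]

lemma intervalIntegrable_pow_mul_one_sub_pow_mul_log (k m : ℕ) (a b : ℝ) :
    IntervalIntegrable (fun t : ℝ => t ^ k * (1 - t) ^ m * Real.log t) volume a b :=
  intervalIntegral.intervalIntegrable_log'.continuousOn_mul (by fun_prop)

lemma integral_pow_mul_log (k : ℕ) :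
    ∫ t in (0 : ℝ)..1, t ^ k * Real.log t = -1 / ((k : ℝ) + 1) ^ 2 := by
  have hk : (k : ℝ) + 1 ≠ 0 := by positivity
  have key := intervalIntegral.integral_eq_sub_of_hasDerivAt_of_le
    (f := fun t : ℝ => t ^ k * (t * Real.log t) / (k + 1) - t ^ (k + 1) / (k + 1) ^ 2)
    (f' := fun t : ℝ => t ^ k * Real.log t) zero_le_one ?_ ?_ ?_
  · rw [key]
    simp
    ring
  · have := Real.continuous_mul_log
    exact Continuous.continuousOn (by fun_prop)
  · intro t ht
    have ht0 : t ≠ 0 := ht.1.ne'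
    have h := (((hasDerivAt_pow (k + 1) t).mul (Real.hasDerivAt_log ht0)).div_const
      ((k : ℝ) + 1)).sub ((hasDerivAt_pow (k + 1) t).div_const (((k : ℝ) + 1) ^ 2))
    refine (h.congr_deriv ?_).congr_of_eventuallyEq (.of_forall fun x => ?_)
    · simp only [Nat.add_sub_cancel]
      push_cast
      field_simp
      ring
    · simp only [Pi.sub_apply, Pi.mul_apply]
      ring
  · simpa using intervalIntegrable_pow_mul_one_sub_pow_mul_log k 0 0 1

lemma integral_pow_mul_one_sub_pow_mul_log (k m : ℕ) :
    ∫ t in (0 : ℝ)..1, t ^ k * (1 - t) ^ m * Real.log t =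
      (k.factorial * m.factorial : ℝ) / ((k + m + 1).factorial : ℝ) *
        (harm k - harm (k + m + 1)) := by
  induction m generalizing k with
  | zero =>
    simp only [pow_zero, mul_one, integral_pow_mul_log, add_zero, harm_succ, Nat.factorial_succ,
      Nat.factorial_zero]
    push_cast
    have : (k.factorial : ℝ) ≠ 0 := by positivity
    field_simp
    ring
  | succ m ih =>
    have hsplit : ∫ t in (0 : ℝ)..1, t ^ k * (1 - t) ^ (m + 1) * Real.log t =
        (∫ t in (0 : ℝ)..1, t ^ k * (1 - t) ^ m * Real.log t) -
          ∫ t in (0 : ℝ)..1, t ^ (k + 1) * (1 - t) ^ m * Real.log t := by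
      rw [← intervalIntegral.integral_sub
        (intervalIntegrable_pow_mul_one_sub_pow_mul_log k m 0 1)
        (intervalIntegrable_pow_mul_one_sub_pow_mul_log (k + 1) m 0 1)]
      congr 1 with t
      ring
    rw [hsplit, ih, ih, show k + 1 + m + 1 = k + m + 1 + 1 by ring,
      show k + (m + 1) + 1 = k + m + 1 + 1 by ring, harm_succ k, harm_succ (k + m + 1),
      Nat.factorial_succ (k + m + 1), Nat.factorial_succ k, Nat.factorial_succ m]
    push_cast
    have : ((k + m + 1).factorial : ℝ) ≠ 0 := by positivity
    field_simp
    ring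

/-- `n · binom(n−1,k) · ∫_0^1 t^k (1−t)^{n−k−1} ln t dt = H_k − H_n`. -/
theorem stmt_17 (n k : ℕ) (h : k < n) :
    (n : ℝ) * ((n - 1).choose k : ℕ) *
        ∫ t in (0 : ℝ)..1, t ^ k * (1 - t) ^ (n - k - 1) * Real.log t =
      harm k - harm n := by
  obtain ⟨m, rfl⟩ := Nat.exists_eq_add_of_lt h
  rw [show k + m + 1 - k - 1 = m by omega, Nat.add_sub_cancel,
    integral_pow_mul_one_sub_pow_mul_log, Nat.factorial_succ, Nat.add_comm k m,
    ← Nat.add_choose_mul_factorial_mul_factorial m k]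
  have hc : (((m + k).choose k : ℕ) : ℝ) ≠ 0 :=
    Nat.cast_ne_zero.mpr (Nat.choose_pos (Nat.le_add_left k m)).ne'
  push_cast
  field_simp
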